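/- Let α ∈ (0,1], T > 0, λ ∈ ℝ, u₀ ∈ ℝ, and let g : [0,T] → ℝ be continuous. If a continuous function u : [0,T] → ℝ satisfies u(t) = u₀ + (1/Γ(α)) ∫₀ᵗ (t−s)^{α−1} (λ·u(s) + g(s)) ds for all t ∈ [0,T], then u admits the variation-of-constants representation u(t) = u₀·E_α(λ t^α) + ∫₀ᵗ (t−s)^{α−1}·E_{α,α}(λ (t−s)^α)·g(s) ds for all t ∈ [0,T]. -/

import Mathlib

open Set intervalIntegral

/-- The one-parameter Mittag-Leffler function `E_α(x) = ∑_{k=0}^∞ x^k / Γ(αk+1)`. -/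
noncomputable def mittagLeffler (α x : ℝ) : ℝ :=
  ∑' k : ℕ, x ^ k / Real.Gamma (α * (k : ℝ) + 1)

/-- The two-parameter Mittag-Leffler function `E_{α,β}(x) = ∑_{k=0}^∞ x^k / Γ(αk+β)`. -/
noncomputable def mittagLeffler₂ (α β x : ℝ) : ℝ :=
  ∑' k : ℕ, x ^ k / Real.Gamma (α * (k : ℝ) + β)

open MeasureTheory

theorem integral_sub_rpow_mul_sub_rpow {β γ r t : ℝ} (hβ : 0 < β) (hγ : 0 < γ) (hrt : r < t) :
    ∫ s in r..t, (t - s) ^ (β - 1) * (s - r) ^ (γ - 1) =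
      Real.Gamma β * Real.Gamma γ / Real.Gamma (β + γ) * (t - r) ^ (β + γ - 1) := by
  have hpos : 0 < t - r := sub_pos.2 hrt
  have h1 : ∫ s in r..t, (t - s) ^ (β - 1) * (s - r) ^ (γ - 1) =
      ∫ x in (0 : ℝ)..(t - r), x ^ (γ - 1) * ((t - r) - x) ^ (β - 1) := by
    have := intervalIntegral.integral_comp_sub_right (a := r) (b := t)
      (fun x : ℝ => x ^ (γ - 1) * ((t - r) - x) ^ (β - 1)) r
    rw [sub_self] at this
    rw [← this]
    refine intervalIntegral.integral_congr fun s _ => ?_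
    simp only [sub_sub_sub_cancel_right]
    ring
  rw [h1]
  have h2 := Complex.betaIntegral_scaled (γ : ℂ) (β : ℂ) hpos
  rw [Complex.betaIntegral_eq_Gamma_mul_div _ _ (by simpa using hγ) (by simpa using hβ)] at h2
  have h3 : ∫ x in (0 : ℝ)..(t - r), (x : ℂ) ^ ((γ : ℂ) - 1) * (((t - r : ℝ) : ℂ) - x) ^ ((β : ℂ) - 1) =
      ((∫ x in (0 : ℝ)..(t - r), x ^ (γ - 1) * ((t - r) - x) ^ (β - 1) : ℝ) : ℂ) := by
    rw [← intervalIntegral.integral_ofReal]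
    refine intervalIntegral.integral_congr fun x hx => ?_
    rw [uIcc_of_le hpos.le] at hx
    simp only [Complex.ofReal_mul]
    rw [Complex.ofReal_cpow hx.1, Complex.ofReal_cpow (sub_nonneg.2 hx.2)]
    push_cast
    rfl
  rw [h3, ← Complex.ofReal_one, ← Complex.ofReal_add, ← Complex.ofReal_sub, ← Complex.ofReal_cpow hpos.le,
    Complex.Gamma_ofReal, Complex.Gamma_ofReal, Complex.Gamma_ofReal] at h2
  have h4 := Complex.ofReal_injective (h2.trans (by push_cast; rfl :
    _ = (((t - r) ^ (γ + β - 1) * (Real.Gamma γ * Real.Gamma β / Real.Gamma (γ + β)) : ℝ) : ℂ)))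
  rw [h4, add_comm γ β]
  ring

theorem intervalIntegrable_sub_rpow_mul_sub_rpow {β γ r t : ℝ} (hβ : 0 < β) (hγ : 0 < γ)
    (hrt : r < t) :
    IntervalIntegrable (fun s => (t - s) ^ (β - 1) * (s - r) ^ (γ - 1)) volume r t := by
  refine intervalIntegral.intervalIntegrable_of_integral_ne_zero ?_
  rw [integral_sub_rpow_mul_sub_rpow hβ hγ hrt]
  have := Real.Gamma_pos_of_pos hβ
  have := Real.Gamma_pos_of_pos hγ
  have := Real.Gamma_pos_of_pos (add_pos hβ hγ)
  have := Real.rpow_pos_of_pos (sub_pos.2 hrt) (β + γ - 1)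
  positivity

theorem intervalIntegrable_sub_rpow {β : ℝ} (hβ : 0 < β) (t : ℝ) :
    IntervalIntegrable (fun s => (t - s) ^ (β - 1)) volume 0 t := by
  have := (intervalIntegral.intervalIntegrable_rpow' (a := 0) (b := t)
    (by linarith : -1 < β - 1)).comp_sub_left t
  simpa using this.symm

theorem integral_sub_rpow {β : ℝ} (hβ : 0 < β) (t : ℝ) :
    ∫ s in (0 : ℝ)..t, (t - s) ^ (β - 1) = t ^ β / β := by
  have := intervalIntegral.integral_comp_sub_left (a := 0) (b := t) (fun x : ℝ => x ^ (β - 1)) t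
  rw [this, integral_rpow (Or.inl (by linarith))]
  simp [Real.zero_rpow hβ.ne']

/-- The Riemann–Liouville fractional integral of order `β`. -/
noncomputable def riemannLiouville (β : ℝ) (f : ℝ → ℝ) (t : ℝ) : ℝ :=
  (1 / Real.Gamma β) * ∫ s in (0 : ℝ)..t, (t - s) ^ (β - 1) * f s

theorem riemannLiouville_const {β : ℝ} (hβ : 0 < β) (c t : ℝ) :
    riemannLiouville β (fun _ => c) t = c * (t ^ β / Real.Gamma (β + 1)) := by
  rw [riemannLiouville, intervalIntegral.integral_mul_const, integral_sub_rpow hβ,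
    Real.Gamma_add_one hβ.ne']
  have := (Real.Gamma_pos_of_pos hβ).ne'
  field_simp

theorem intervalIntegrable_sub_rpow_mul {β t : ℝ} (hβ : 0 < β) (ht : 0 ≤ t) {f : ℝ → ℝ}
    (hf : ContinuousOn f (Icc 0 t)) :
    IntervalIntegrable (fun s => (t - s) ^ (β - 1) * f s) volume 0 t :=
  (intervalIntegrable_sub_rpow hβ t).mul_continuousOn (by rwa [uIcc_of_le ht])

theorem riemannLiouville_add {β t : ℝ} (hβ : 0 < β) (ht : 0 ≤ t) {f g : ℝ → ℝ}
    (hf : ContinuousOn f (Icc 0 t)) (hg : ContinuousOn g (Icc 0 t)) :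
    riemannLiouville β (fun s => f s + g s) t =
      riemannLiouville β f t + riemannLiouville β g t := by
  simp only [riemannLiouville, mul_add]
  rw [intervalIntegral.integral_add (intervalIntegrable_sub_rpow_mul hβ ht hf)
    (intervalIntegrable_sub_rpow_mul hβ ht hg), mul_add]

theorem riemannLiouville_const_mul (β c t : ℝ) (f : ℝ → ℝ) :
    riemannLiouville β (fun s => c * f s) t = c * riemannLiouville β f t := by
  simp only [riemannLiouville, mul_left_comm _ c, intervalIntegral.integral_const_mul]

theorem riemannLiouville_congr {β t : ℝ} (ht : 0 ≤ t) {f g : ℝ → ℝ} (h : EqOn f g (Icc 0 t)) :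
    riemannLiouville β f t = riemannLiouville β g t := by
  rw [riemannLiouville, riemannLiouville]
  congr 1
  refine intervalIntegral.integral_congr fun s hs => ?_
  rw [uIcc_of_le ht] at hs
  simp only [h hs]

theorem integral_norm_sub_rpow_mul_le {β t M : ℝ} (hβ : 0 < β) (ht : 0 ≤ t) {f : ℝ → ℝ}
    (hf : ContinuousOn f (Icc 0 t)) (hM : ∀ s ∈ Icc 0 t, |f s| ≤ M) :
    ∫ s in (0 : ℝ)..t, ‖(t - s) ^ (β - 1) * f s‖ ≤ M * (t ^ β / β) := by
  rw [← integral_sub_rpow hβ, ← intervalIntegral.integral_const_mul]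
  refine intervalIntegral.integral_mono_on ht
    (intervalIntegrable_sub_rpow_mul hβ ht hf).norm
    ((intervalIntegrable_sub_rpow hβ t).const_mul M) fun s hs => ?_
  have h0 : 0 ≤ (t - s) ^ (β - 1) := Real.rpow_nonneg (sub_nonneg.2 hs.2) _
  rw [norm_mul, Real.norm_of_nonneg h0, mul_comm]
  exact mul_le_mul_of_nonneg_right (hM s hs) h0

theorem abs_riemannLiouville_le {β t M : ℝ} (hβ : 0 < β) (ht : 0 ≤ t) {f : ℝ → ℝ}
    (hf : ContinuousOn f (Icc 0 t)) (hM : ∀ s ∈ Icc 0 t, |f s| ≤ M) :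
    |riemannLiouville β f t| ≤ M * (t ^ β / Real.Gamma (β + 1)) := by
  have hG := Real.Gamma_pos_of_pos hβ
  rw [riemannLiouville, abs_mul, abs_of_pos (one_div_pos.2 hG), Real.Gamma_add_one hβ.ne']
  have h := (intervalIntegral.norm_integral_le_integral_norm ht).trans
    (integral_norm_sub_rpow_mul_le hβ ht hf hM)
  rw [Real.norm_eq_abs] at h
  calc _ ≤ 1 / Real.Gamma β * (M * (t ^ β / β)) := by gcongr
    _ = _ := by field_simp

theorem riemannLiouville_riemannLiouville {β γ t : ℝ} (hβ : 0 < β) (hγ : 0 < γ) (ht : 0 ≤ t)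
    {f : ℝ → ℝ} (hf : ContinuousOn f (Icc 0 t)) :
    riemannLiouville β (riemannLiouville γ f) t = riemannLiouville (β + γ) f t := by
  set μ := (volume : Measure ℝ).restrict (Ioc 0 t) with hμ
  let K : ℝ → ℝ → ℝ := fun r s =>
    (Ioc r t).indicator (fun s => (t - s) ^ (β - 1) * (s - r) ^ (γ - 1)) s
  set B := Real.Gamma β * Real.Gamma γ / Real.Gamma (β + γ) with hB
  have hGβ := Real.Gamma_pos_of_pos hβ
  have hGγ := Real.Gamma_pos_of_pos hγ
  have hGβγ := Real.Gamma_pos_of_pos (add_pos hβ hγ)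
  have hae : ∀ᵐ r ∂μ, r ∈ Ioo 0 t := by
    rw [hμ, ← Measure.restrict_congr_set Ioo_ae_eq_Ioc]
    exact ae_restrict_mem measurableSet_Ioo
  have hKnn : ∀ r s, 0 ≤ K r s := fun r s => indicator_nonneg
    (fun s hs => mul_nonneg (Real.rpow_nonneg (sub_nonneg.2 hs.2) _)
      (Real.rpow_nonneg (sub_nonneg.2 hs.1.le) _)) s
  have hKint : ∀ r ∈ Ioo 0 t, Integrable (K r) μ := fun r hr =>
    ((integrable_indicator_iff measurableSet_Ioc).2 ((intervalIntegrable_iff_integrableOn_Ioc_of_le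
      hr.2.le).1 (intervalIntegrable_sub_rpow_mul_sub_rpow hβ hγ hr.2))).restrict
  have hKval : ∀ r ∈ Ioo 0 t, ∫ s, K r s ∂μ = B * (t - r) ^ (β + γ - 1) := fun r hr => by
    rw [setIntegral_indicator measurableSet_Ioc,
      inter_eq_self_of_subset_right (Ioc_subset_Ioc_left hr.1.le),
      ← intervalIntegral.integral_of_le hr.2.le, integral_sub_rpow_mul_sub_rpow hβ hγ hr.2]
  have hfm : AEStronglyMeasurable f μ :=
    (hf.mono Ioc_subset_Icc_self).aestronglyMeasurable measurableSet_Ioc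
  have hKm : Measurable (Function.uncurry K) := by
    have : Function.uncurry K = {p : ℝ × ℝ | p.1 < p.2 ∧ p.2 ≤ t}.indicator
        (fun p => (t - p.2) ^ (β - 1) * (p.2 - p.1) ^ (γ - 1)) := by
      ext ⟨r, s⟩
      simp [K, Function.uncurry, indicator, mem_Ioc]
    rw [this]
    refine Measurable.indicator (by fun_prop) ?_
    exact (measurableSet_lt measurable_fst measurable_snd).inter
      (measurableSet_le measurable_snd measurable_const)
  have hint : Integrable (Function.uncurry fun r s => K r s * f r) (μ.prod μ) := by
    refine (integrable_prod_iff (hKm.aestronglyMeasurable.mul hfm.comp_fst)).2 ⟨?_, ?_⟩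
    · filter_upwards [hae] with r hr
      exact (hKint r hr).mul_const (f r)
    · have h1 : Integrable (fun r => B * ‖(t - r) ^ (β + γ - 1) * f r‖) μ :=
        (((intervalIntegrable_iff_integrableOn_Ioc_of_le ht).1
          (intervalIntegrable_sub_rpow_mul (add_pos hβ hγ) ht hf)).norm).const_mul B
      refine h1.congr ?_
      filter_upwards [hae] with r hr
      have h0 : 0 ≤ (t - r) ^ (β + γ - 1) := Real.rpow_nonneg (sub_nonneg.2 hr.2.le) _
      simp only [Pi.mul_apply, Function.uncurry_apply_pair, norm_mul, Real.norm_of_nonneg (hKnn r _),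
        Real.norm_of_nonneg h0]
      rw [MeasureTheory.integral_mul_const, hKval r hr, mul_assoc]
  have hswap := integral_integral_swap hint
  have hL : ∫ r, ∫ s, K r s * f r ∂μ ∂μ = B * ∫ s in (0 : ℝ)..t, (t - s) ^ (β + γ - 1) * f s := by
    rw [intervalIntegral.integral_of_le ht, ← MeasureTheory.integral_const_mul]
    refine integral_congr_ae ?_
    filter_upwards [hae] with r hr
    rw [MeasureTheory.integral_mul_const, hKval r hr, mul_assoc]
  have hR : ∫ s, ∫ r, K r s * f r ∂μ ∂μ =
      Real.Gamma γ * ∫ s in (0 : ℝ)..t, (t - s) ^ (β - 1) * riemannLiouville γ f s := by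
    rw [intervalIntegral.integral_of_le ht, ← MeasureTheory.integral_const_mul]
    refine integral_congr_ae ?_
    filter_upwards [hae] with s hs
    have h1 : ∀ r, K r s * f r = (Iio s).indicator
        (fun r => (t - s) ^ (β - 1) * ((s - r) ^ (γ - 1) * f r)) r := fun r => by
      by_cases h : r < s
      · simp [K, indicator, h, hs.2.le, mul_assoc]
      · simp [K, indicator, h]
    have h2 : Ioc 0 t ∩ Iio s = Ioo 0 s := by
      ext x
      simp only [mem_inter_iff, mem_Ioc, mem_Iio, mem_Ioo]
      exact ⟨fun h => ⟨h.1.1, h.2⟩, fun h => ⟨⟨h.1, (h.2.trans hs.2).le⟩, h.2⟩⟩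
    simp only [h1]
    rw [setIntegral_indicator measurableSet_Iio, h2, ← integral_Ioc_eq_integral_Ioo,
      ← intervalIntegral.integral_of_le hs.1.le, intervalIntegral.integral_const_mul,
      riemannLiouville]
    field_simp
  rw [hL, hR] at hswap
  have h3 : ∫ s in (0 : ℝ)..t, (t - s) ^ (β - 1) * riemannLiouville γ f s =
      B / Real.Gamma γ * ∫ s in (0 : ℝ)..t, (t - s) ^ (β + γ - 1) * f s := by
    field_simp
    linarith
  rw [riemannLiouville, h3, riemannLiouville, hB]
  field_simp

theorem rpow_mul_exp_neg_le_Gamma_add_one {C x : ℝ} (hC : 0 < C) (hx : 0 ≤ x) :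
    C ^ x * Real.exp (-C) ≤ Real.Gamma (x + 1) := by
  have hi := Real.GammaIntegral_convergent (s := x + 1) (by linarith)
  rw [Real.Gamma_eq_integral (by linarith), ← integral_exp_neg_Ioi C, ← MeasureTheory.integral_const_mul]
  have hsub : Ioi C ⊆ Ioi (0 : ℝ) := Ioi_subset_Ioi hC.le
  refine le_trans (setIntegral_mono_on ((integrableOn_exp_neg_Ioi C).const_mul _)
    (hi.mono_set hsub) measurableSet_Ioi fun y hy => ?_)
    (setIntegral_mono_set hi ?_ hsub.eventuallyLE)
  · rw [mul_comm, add_sub_cancel_right]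
    gcongr
    exact le_of_lt hy
  · filter_upwards [ae_restrict_mem measurableSet_Ioi] with y hy
    exact mul_nonneg (Real.exp_pos _).le (Real.rpow_nonneg (le_of_lt hy) _)

theorem summable_pow_div_Gamma {α : ℝ} (hα : 0 < α) (x : ℝ) :
    Summable fun k : ℕ => x ^ k / Real.Gamma (α * k + 1) := by
  set C : ℝ := (2 * (|x| + 1)) ^ α⁻¹ with hC
  have hx := abs_nonneg x
  have hCpos : 0 < C := Real.rpow_pos_of_pos (by linarith) _
  have hCα : C ^ α = 2 * (|x| + 1) := Real.rpow_inv_rpow (by linarith) hα.ne'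
  have hgeo : Summable fun k : ℕ => Real.exp C * (|x| / (2 * (|x| + 1))) ^ k :=
    (summable_geometric_of_lt_one (by positivity)
      ((div_lt_one (by linarith)).2 (by linarith))).mul_left _
  refine Summable.of_norm_bounded hgeo fun k => ?_
  have hk : 0 ≤ α * k := by positivity
  have hG := rpow_mul_exp_neg_le_Gamma_add_one hCpos hk
  have hGpos : 0 < Real.Gamma (α * k + 1) := Real.Gamma_pos_of_pos (by linarith)
  rw [Real.rpow_mul_natCast hCpos.le, hCα, Real.exp_neg] at hG
  rw [norm_div, norm_pow, Real.norm_eq_abs, Real.norm_of_nonneg hGpos.le]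
  calc |x| ^ k / Real.Gamma (α * k + 1)
      ≤ |x| ^ k / ((2 * (|x| + 1)) ^ k * (Real.exp C)⁻¹) := by gcongr
    _ = _ := by
      rw [div_pow]
      field_simp


theorem eq_sum_add_riemannLiouville {α T lam u₀ : ℝ} (hα : 0 < α) {g u : ℝ → ℝ}
    (hg : ContinuousOn g (Icc 0 T)) (hu : ContinuousOn u (Icc 0 T))
    (heq : ∀ t ∈ Icc 0 T, u t = u₀ + riemannLiouville α (fun s => lam * u s + g s) t)
    {t : ℝ} (ht : t ∈ Icc 0 T) (n : ℕ) :
    u t = ∑ k ∈ Finset.range (n + 1), u₀ * ((lam * t ^ α) ^ k / Real.Gamma (α * k + 1)) +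
      ∑ k ∈ Finset.range (n + 1), lam ^ k * riemannLiouville (α * (k + 1)) g t +
      lam ^ (n + 1) * riemannLiouville (α * (n + 1)) u t := by
  have hsub : Icc 0 t ⊆ Icc 0 T := Icc_subset_Icc_right ht.2
  have hgt := hg.mono hsub
  have hut := hu.mono hsub
  have hlam : ContinuousOn (fun s => lam * u s) (Icc 0 t) := continuousOn_const.mul hut
  induction n with
  | zero =>
    rw [heq t ht, riemannLiouville_add hα ht.1 hlam hgt, riemannLiouville_const_mul]
    simp
    ring
  | succ n ih =>
    have hβ : 0 < α * ((n : ℝ) + 1) := by positivity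
    have hstep : riemannLiouville (α * ((n : ℝ) + 1)) u t =
        u₀ * ((t ^ α) ^ (n + 1) / Real.Gamma (α * ((n : ℝ) + 1) + 1)) +
          (lam * riemannLiouville (α * ((n : ℝ) + 1 + 1)) u t +
            riemannLiouville (α * ((n : ℝ) + 1 + 1)) g t) := by
      have hcont : ContinuousOn (riemannLiouville α fun s => lam * u s + g s) (Icc 0 t) :=
        (hut.sub (continuousOn_const (c := u₀))).congr fun s hs => by
          rw [Pi.sub_apply, heq s (hsub hs), add_sub_cancel_left]
      have hw : ContinuousOn (fun s => lam * u s + g s) (Icc 0 t) := hlam.add hgt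
      rw [riemannLiouville_congr ht.1 fun s hs => heq s (hsub hs),
        riemannLiouville_add hβ ht.1 continuousOn_const hcont, riemannLiouville_const hβ,
        riemannLiouville_riemannLiouville hβ hα ht.1 hw,
        show α * ((n : ℝ) + 1) + α = α * ((n : ℝ) + 1 + 1) by ring,
        riemannLiouville_add (by positivity) ht.1 hlam hgt, riemannLiouville_const_mul,
        ← Real.rpow_mul_natCast ht.1]
      push_cast
      rfl
    rw [Finset.sum_range_succ, Finset.sum_range_succ _ (n + 1), ih, hstep]
    push_cast
    ring

theorem hasSum_pow_mul_riemannLiouville {α t : ℝ} (hα : 0 < α) (ht : 0 ≤ t) (lam : ℝ) {g : ℝ → ℝ}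
    (hg : ContinuousOn g (Icc 0 t)) :
    HasSum (fun k : ℕ => lam ^ k * riemannLiouville (α * (k + 1)) g t)
      (∫ s in (0 : ℝ)..t,
        (t - s) ^ (α - 1) * mittagLeffler₂ α α (lam * (t - s) ^ α) * g s) := by
  obtain ⟨M, hM⟩ := isCompact_Icc.exists_bound_of_continuousOn hg
  have hpos : ∀ k : ℕ, 0 < α * ((k : ℝ) + 1) := fun k => by positivity
  have hGpos : ∀ k : ℕ, 0 < Real.Gamma (α * ((k : ℝ) + 1)) := fun k =>
    Real.Gamma_pos_of_pos (hpos k)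
  set F : ℕ → ℝ → ℝ := fun k s =>
    lam ^ k / Real.Gamma (α * (k + 1)) * ((t - s) ^ (α * ((k : ℝ) + 1) - 1) * g s) with hF
  have hFint : ∀ k, Integrable (F k) (volume.restrict (Ioc 0 t)) := fun k =>
    ((intervalIntegrable_iff_integrableOn_Ioc_of_le ht).1
      (intervalIntegrable_sub_rpow_mul (hpos k) ht hg)).const_mul _
  have hsum : Summable fun k : ℕ => M *
      (((|lam| + 1) * t ^ α) ^ (k + 1) / Real.Gamma (α * ((k + 1 : ℕ) : ℝ) + 1)) :=
    ((summable_nat_add_iff 1).2 (summable_pow_div_Gamma hα ((|lam| + 1) * t ^ α))).mul_left M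
  have hFsum : Summable fun k => ∫ s, ‖F k s‖ ∂volume.restrict (Ioc 0 t) := by
    refine Summable.of_nonneg_of_le (fun k => integral_nonneg fun _ => norm_nonneg _)
      (fun k => ?_) hsum
    have h := integral_norm_sub_rpow_mul_le (hpos k) ht hg hM
    have hG := hGpos k
    rw [intervalIntegral.integral_of_le ht] at h
    simp only [hF, norm_mul (lam ^ k / _)]
    rw [MeasureTheory.integral_const_mul, norm_div, norm_pow, Real.norm_eq_abs,
      Real.norm_of_nonneg hG.le]
    have hM0 : 0 ≤ M := (norm_nonneg _).trans (hM 0 ⟨le_rfl, ht⟩)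
    have hlam : |lam| ^ k ≤ (|lam| + 1) ^ (k + 1) :=
      (pow_le_pow_left₀ (abs_nonneg _) (by linarith) k).trans
        (pow_le_pow_right₀ (by linarith [abs_nonneg lam]) k.le_succ)
    have hk := hpos k
    have htk := Real.rpow_nonneg ht (α * ((k : ℝ) + 1))
    calc _ ≤ (|lam| + 1) ^ (k + 1) / Real.Gamma (α * (k + 1)) *
          (M * (t ^ (α * ((k : ℝ) + 1)) / (α * (k + 1)))) := by gcongr
      _ = _ := by
        rw [mul_pow, ← Real.rpow_mul_natCast ht, Nat.cast_succ, Real.Gamma_add_one hk.ne']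
        field_simp
  have h := hasSum_integral_of_summable_integral_norm hFint hFsum
  rw [intervalIntegral.integral_of_le ht]
  have hterm : (fun k : ℕ => lam ^ k * riemannLiouville (α * (k + 1)) g t) =
      fun k => ∫ s in Ioc 0 t, F k s := by
    funext k
    rw [riemannLiouville, intervalIntegral.integral_of_le ht, MeasureTheory.integral_const_mul]
    ring
  have hlimit : ∫ s in Ioc 0 t,
      (t - s) ^ (α - 1) * mittagLeffler₂ α α (lam * (t - s) ^ α) * g s =
        ∫ s in Ioc 0 t, ∑' k, F k s := by
    refine MeasureTheory.integral_congr_ae ?_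
    have hae : ∀ᵐ s ∂volume.restrict (Ioc 0 t), s ∈ Ioo 0 t := by
      rw [← Measure.restrict_congr_set Ioo_ae_eq_Ioc]
      exact ae_restrict_mem measurableSet_Ioo
    filter_upwards [hae] with s hs
    have hts : 0 < t - s := sub_pos.2 hs.2
    rw [mittagLeffler₂, ← tsum_mul_left, ← tsum_mul_right]
    refine tsum_congr fun k => ?_
    rw [hF]
    simp only
    rw [show α * ((k : ℝ) + 1) - 1 = (α - 1) + α * k by ring, Real.rpow_add hts,
      Real.rpow_mul_natCast hts.le, mul_pow, mul_add_one]
    ring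
  rw [hterm, hlimit]
  exact h

/-- Variation-of-constants representation: a continuous solution of the Volterra
integral equation with right-hand side `λ·u(s) + g(s)` satisfies
`u(t) = u₀·E_α(λt^α) + ∫₀ᵗ (t−s)^{α−1} E_{α,α}(λ(t−s)^α) g(s) ds`. -/
theorem caputo_variation_of_constants (α T lam u₀ : ℝ) (hα : 0 < α) (hα1 : α ≤ 1)
    (hT : 0 < T) (g u : ℝ → ℝ)
    (hg : ContinuousOn g (Set.Icc 0 T)) (hu : ContinuousOn u (Set.Icc 0 T))
    (heq : ∀ t ∈ Set.Icc 0 T,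
      u t = u₀ + (1 / Real.Gamma α) *
        ∫ s in (0:ℝ)..t, (t - s) ^ (α - 1) * (lam * u s + g s)) :
    ∀ t ∈ Set.Icc 0 T,
      u t = u₀ * mittagLeffler α (lam * t ^ α) +
        ∫ s in (0:ℝ)..t,
          (t - s) ^ (α - 1) * mittagLeffler₂ α α (lam * (t - s) ^ α) * g s := by
  intro t ht
  have hsub : Icc 0 t ⊆ Icc 0 T := Icc_subset_Icc_right ht.2
  have h₁ : HasSum (fun k : ℕ => u₀ * ((lam * t ^ α) ^ k / Real.Gamma (α * k + 1)))
      (u₀ * mittagLeffler α (lam * t ^ α)) :=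
    (summable_pow_div_Gamma hα _).hasSum.mul_left u₀
  have h₂ := hasSum_pow_mul_riemannLiouville hα ht.1 lam (hg.mono hsub)
  have h₃ := (hasSum_pow_mul_riemannLiouville hα ht.1 lam
    (hu.mono hsub)).summable.tendsto_atTop_zero.const_mul lam
  have h := (((h₁.tendsto_sum_nat.comp (Filter.tendsto_add_atTop_nat 1)).add
    (h₂.tendsto_sum_nat.comp (Filter.tendsto_add_atTop_nat 1))).add h₃)
  rw [mul_zero, add_zero] at h
  refine tendsto_nhds_unique (tendsto_const_nhds.congr fun n => ?_) h
  rw [eq_sum_add_riemannLiouville hα hg hu heq ht n, pow_succ']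
  simp only [Function.comp_apply, mul_assoc]
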